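/- arXiv:2408.16781 — 8 statements merged into one kernel-verified Lean document; each statement's English description precedes it below -/
import Mathlib

section
/- Let G be a finite group such that every two non-trivial cyclic subgroups of G have the same Chermak–Delgado measure. Then G is a p-group for some prime p, i.e., the order of G is a power of a prime. -/
/-- The Chermak–Delgado measure of a subgroup `H` of `G`:
`m_G(H) = |H| * |C_G(H)|`. -/
noncomputable def cdMeasure (G : Type*) [Group G] (H : Subgroup G) : ℕ :=
  Nat.card H * Nat.card (Subgroup.centralizer (H : Set G))

theorem Subgroup.zpowers_ne_bot_and_isCyclic_and_card_eq {G : Type*} [Group G] {x : G} {p : ℕ}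
    (hp : p.Prime) (hx : orderOf x = p) :
    Subgroup.zpowers x ≠ ⊥ ∧ IsCyclic (Subgroup.zpowers x) ∧
      Nat.card (Subgroup.zpowers x) = p := by
  refine ⟨fun hbot => ?_, inferInstance, by rw [Nat.card_zpowers, hx]⟩
  rw [Subgroup.zpowers_eq_bot] at hbot
  exact hp.one_lt.ne' (by rw [← hx, hbot, orderOf_one])

/-- If `p` divides the order of `G`, some element of order `p` is centralized by a Sylow
`p`-subgroup. -/
theorem Sylow.exists_orderOf_eq_le_centralizer {G : Type*} [Group G] [Finite G] {p : ℕ}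
    [Fact p.Prime] (hdvd : p ∣ Nat.card G) (P : Sylow p G) :
    ∃ z : G, orderOf z = p ∧
      (P : Subgroup G) ≤ Subgroup.centralizer (Subgroup.zpowers z : Set G) := by
  have : Nontrivial P := (P : Subgroup G).nontrivial_iff_ne_bot.mpr (P.ne_bot_of_dvd_card hdvd)
  have := P.isPGroup'.center_nontrivial
  obtain ⟨n, hn, hcard⟩ :=
    (P.isPGroup'.to_subgroup (Subgroup.center P)).nontrivial_iff_card.mp this
  obtain ⟨z, hz⟩ := exists_prime_orderOf_dvd_card' (G := Subgroup.center P) p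
    (hcard ▸ dvd_pow_self p hn.ne')
  refine ⟨((z : P) : G), by rw [Subgroup.orderOf_coe, Subgroup.orderOf_coe, hz], fun g hg => ?_⟩
  rw [Subgroup.mem_centralizer_iff]
  intro x hx
  obtain ⟨k, rfl⟩ := Subgroup.mem_zpowers_iff.mp hx
  have hcomm : Commute ((z : P) : G) g :=
    (congrArg Subtype.val (Subgroup.mem_center_iff.mp z.2 ⟨g, hg⟩)).symm
  exact hcomm.zpow_left k

/-- If every two non-trivial cyclic subgroups of a finite group `G` have the same
Chermak–Delgado measure, then `G` is a `p`-group for some prime `p`. -/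
theorem stmt_0 (G : Type*) [Group G] [Finite G]
    (h : ∀ H₁ H₂ : Subgroup G, H₁ ≠ ⊥ → H₂ ≠ ⊥ → IsCyclic H₁ → IsCyclic H₂ →
      cdMeasure G H₁ = cdMeasure G H₂) :
    ∃ (p n : ℕ), p.Prime ∧ Nat.card G = p ^ n := by
  obtain hG | hG := eq_or_ne (Nat.card G) 1
  · exact ⟨2, 0, Nat.prime_two, by simpa using hG⟩
  obtain ⟨p, hp, hpG⟩ := Nat.exists_prime_and_dvd hG
  have : Fact p.Prime := ⟨hp⟩
  refine ⟨p, _, hp, Nat.eq_prime_pow_of_unique_prime_dvd Nat.card_pos.ne' ?_⟩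
  intro q hq hqG
  by_contra hqp
  have : Fact q.Prime := ⟨hq⟩
  let P : Sylow p G := default
  obtain ⟨z, hz, hPz⟩ := P.exists_orderOf_eq_le_centralizer hpG
  obtain ⟨y, hy⟩ := exists_prime_orderOf_dvd_card' (G := G) q hqG
  obtain ⟨hz_bot, hz_cyc, hz_card⟩ := Subgroup.zpowers_ne_bot_and_isCyclic_and_card_eq hp hz
  obtain ⟨hy_bot, hy_cyc, hy_card⟩ := Subgroup.zpowers_ne_bot_and_isCyclic_and_card_eq hq hy
  have hm := h _ _ hz_bot hy_bot hz_cyc hy_cyc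
  rw [cdMeasure, cdMeasure, hz_card, hy_card] at hm
  have hdvd : p * Nat.card P ∣ q * Nat.card G :=
    (mul_dvd_mul_left p (Subgroup.card_dvd_of_le hPz)).trans
      (hm ▸ mul_dvd_mul_left q (Subgroup.card_subgroup_dvd_card _))
  rw [P.card_eq_multiplicity, ← pow_succ'] at hdvd
  have hcop : Nat.Coprime (p ^ ((Nat.card G).factorization p + 1)) q :=
    Nat.Coprime.pow_left _ ((Nat.coprime_primes hp hq).mpr (Ne.symm hqp))
  exact Nat.pow_succ_factorization_not_dvd Nat.card_pos.ne' hp (hcop.dvd_of_dvd_mul_left hdvd)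
end

section
/- Let p be a prime and let G be a finite p-group such that every two non-trivial cyclic subgroups of G have the same Chermak–Delgado measure. Then every element of order p in G is central, i.e., Ω₁(G) ≤ Z(G), where Ω₁(G) is the subgroup generated by the elements of order p. -/
/-- In a finite p-group all of whose non-trivial cyclic subgroups have the same
Chermak–Delgado measure, every element of order p is central, i.e. Ω₁(G) ≤ Z(G). -/
theorem stmt_1 (p : ℕ) (hp : p.Prime) (G : Type*) [Group G] [Finite G]
    (hpG : IsPGroup p G)
    (h : ∀ H₁ H₂ : Subgroup G, H₁ ≠ ⊥ → H₂ ≠ ⊥ → IsCyclic H₁ → IsCyclic H₂ →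
      cdMeasure G H₁ = cdMeasure G H₂) :
    (∀ g : G, orderOf g = p → g ∈ Subgroup.center G) ∧
      Subgroup.closure {g : G | orderOf g = p} ≤ Subgroup.center G := by
  have : Fact p.Prime := ⟨hp⟩
  have card_centralizer (x y : G) (hx : orderOf x = p) (hy : orderOf y = p) :
      Nat.card (Subgroup.centralizer (Subgroup.zpowers x : Set G)) =
        Nat.card (Subgroup.centralizer (Subgroup.zpowers y : Set G)) := by
    have zpowers_ne_bot (z : G) (hz : orderOf z = p) : Subgroup.zpowers z ≠ ⊥ := by
      rw [Ne, Subgroup.zpowers_eq_bot]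
      rintro rfl
      exact hp.ne_one (hz.symm.trans orderOf_one)
    have hxy := h _ _ (zpowers_ne_bot x hx) (zpowers_ne_bot y hy) inferInstance inferInstance
    simp only [cdMeasure, Nat.card_zpowers, hx, hy] at hxy
    exact Nat.eq_of_mul_eq_mul_left hp.pos hxy
  have mem_center (g : G) (hg : orderOf g = p) : g ∈ Subgroup.center G := by
    have : Nontrivial G := ⟨g, 1, by
      rintro rfl
      exact hp.ne_one (hg.symm.trans orderOf_one)⟩
    have := hpG.center_nontrivial
    obtain ⟨n, hn, hcard⟩ := (hpG.to_subgroup (Subgroup.center G)).nontrivial_iff_card.mp this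
    obtain ⟨z, hz⟩ := exists_prime_orderOf_dvd_card' (G := Subgroup.center G) p
      (hcard ▸ dvd_pow_self p hn.ne')
    have hz' : orderOf (z : G) = p := by rw [Subgroup.orderOf_coe, hz]
    have hcentral : Subgroup.centralizer (Subgroup.zpowers (z : G) : Set G) = ⊤ :=
      Subgroup.centralizer_eq_top_iff_subset.mpr
        ((Subgroup.zpowers_le (H := Subgroup.center G)).mpr z.2)
    have htop : Subgroup.centralizer (Subgroup.zpowers g : Set G) = ⊤ := by
      apply Subgroup.eq_top_of_card_eq
      rw [card_centralizer g z hg hz', hcentral, Subgroup.card_top]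
    exact Subgroup.centralizer_eq_top_iff_subset.mp htop (Subgroup.mem_zpowers g)
  exact ⟨mem_center, (Subgroup.closure_le _).mpr mem_center⟩
end

section
/- Let p be a prime and let G be a finite p-group such that every two non-trivial cyclic subgroups of G have the same Chermak–Delgado measure. Then the center Z(G) equals the subgroup Ω₁(G) generated by the elements of order p; in particular, every non-trivial element of the center Z(G) has order p. -/
theorem cdMeasure_zpowers_of_mem_center {G : Type*} [Group G] {g : G}
    (hg : g ∈ Subgroup.center G) :
    cdMeasure G (Subgroup.zpowers g) = orderOf g * Nat.card G := by
  have hc : Subgroup.centralizer (Subgroup.zpowers g : Set G) = ⊤ := by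
    rw [Subgroup.centralizer_eq_top_iff_subset]
    exact (Subgroup.zpowers_le).2 hg
  rw [cdMeasure, hc, Nat.card_zpowers, Subgroup.card_top]

theorem mem_center_of_cdMeasure_zpowers_eq {G : Type*} [Group G] [Finite G] {g : G}
    (hg : cdMeasure G (Subgroup.zpowers g) = orderOf g * Nat.card G) :
    g ∈ Subgroup.center G := by
  rw [cdMeasure, Nat.card_zpowers] at hg
  have hc := Subgroup.eq_top_of_card_eq _ (Nat.eq_of_mul_eq_mul_left (orderOf_pos g) hg)
  rw [Subgroup.centralizer_eq_top_iff_subset] at hc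
  exact hc (Subgroup.mem_zpowers g)

/-- In a finite p-group all of whose non-trivial cyclic subgroups have the same
Chermak–Delgado measure, the center equals Ω₁(G), the subgroup generated by the
elements of order p; in particular every non-trivial central element has order p. -/
theorem stmt_2 (p : ℕ) (hp : p.Prime) (G : Type*) [Group G] [Finite G]
    (hpG : IsPGroup p G)
    (h : ∀ H₁ H₂ : Subgroup G, H₁ ≠ ⊥ → H₂ ≠ ⊥ → IsCyclic H₁ → IsCyclic H₂ →
      cdMeasure G H₁ = cdMeasure G H₂) :
    Subgroup.center G = Subgroup.closure {g : G | orderOf g = p} ∧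
      ∀ g ∈ Subgroup.center G, g ≠ 1 → orderOf g = p := by
  have := Fact.mk hp
  have heq {a b : G} (ha : a ≠ 1) (hb : b ≠ 1) :
      cdMeasure G (Subgroup.zpowers a) = cdMeasure G (Subgroup.zpowers b) :=
    h _ _ (Subgroup.zpowers_ne_bot.2 ha) (Subgroup.zpowers_ne_bot.2 hb)
      inferInstance inferInstance
  have hne {a : G} (ha : orderOf a = p) : a ≠ 1 := by
    rintro rfl
    exact hp.one_lt.ne (orderOf_one.symm.trans ha)
  have hexists [Nontrivial G] : ∃ z ∈ Subgroup.center G, orderOf z = p := by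
    obtain ⟨n, hn, hcard⟩ :=
      (hpG.to_subgroup (Subgroup.center G)).nontrivial_iff_card.1 hpG.center_nontrivial
    obtain ⟨z, hz⟩ := exists_prime_orderOf_dvd_card' (G := Subgroup.center G) p
      (hcard ▸ dvd_pow_self p hn.ne')
    exact ⟨z, z.2, (Subgroup.orderOf_coe z).trans hz⟩
  have hcenter : ∀ g ∈ Subgroup.center G, g ≠ 1 → orderOf g = p := by
    intro g hg hg1
    have : Nontrivial G := ⟨g, 1, hg1⟩
    obtain ⟨z, hz, hzp⟩ := hexists
    have hgz := heq hg1 (hne hzp)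
    rw [cdMeasure_zpowers_of_mem_center hg, cdMeasure_zpowers_of_mem_center hz, hzp] at hgz
    exact Nat.eq_of_mul_eq_mul_right Nat.card_pos hgz
  refine ⟨le_antisymm (fun g hg => ?_) ((Subgroup.closure_le _).2 fun g hg => ?_), hcenter⟩
  · by_cases hg1 : g = 1
    · exact hg1 ▸ one_mem _
    · exact Subgroup.subset_closure (hcenter g hg hg1)
  · have : Nontrivial G := ⟨g, 1, hne hg⟩
    obtain ⟨z, hz, hzp⟩ := hexists
    refine mem_center_of_cdMeasure_zpowers_eq ?_
    rw [heq (hne hg) (hne hzp), cdMeasure_zpowers_of_mem_center hz, hzp, show orderOf g = p from hg]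
end

section
/- Let p be a prime and let G be a finite group with |G| = p^n, exponent exp(G) = p^m, and center of order |Z(G)| = p^k, such that every two non-trivial cyclic subgroups of G have the same Chermak–Delgado measure. Then k ≤ n − 2m + 2. -/
theorem cdMeasure_of_le_center {G : Type*} [Group G] {H : Subgroup G}
    (hH : H ≤ Subgroup.center G) : cdMeasure G H = Nat.card H * Nat.card G := by
  rw [cdMeasure, Subgroup.centralizer_eq_top_iff_subset.2 hH, Subgroup.card_top]

theorem Subgroup.card_mul_card_le_card_inf_mul_card {G : Type*} [Group G] [Finite G]
    {H K L : Subgroup G} (hH : H ≤ L) (hK : K ≤ L) :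
    Nat.card H * Nat.card K ≤ Nat.card (H ⊓ K : Subgroup G) * Nat.card L := by
  have hrel : H.relIndex K ≤ H.relIndex L :=
    Subgroup.relIndex_le_of_le_right hK Subgroup.index_ne_zero_of_finite
  have hcardK := Subgroup.relIndex_mul_relIndex ⊥ (H ⊓ K) K bot_le inf_le_right
  have hcardL := Subgroup.relIndex_mul_relIndex ⊥ H L bot_le hH
  simp only [Subgroup.relIndex_bot_left, Subgroup.inf_relIndex_right] at hcardK hcardL
  rw [← hcardK, ← hcardL, mul_left_comm]
  gcongr

/-- If |G| = p^n, exp(G) = p^m, |Z(G)| = p^k, and all non-trivial cyclic subgroups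
of G have the same Chermak–Delgado measure, then k ≤ n - 2m + 2. -/
theorem stmt_4 (p : ℕ) (hp : p.Prime) (n m k : ℕ) (G : Type*) [Group G] [Finite G]
    (hcard : Nat.card G = p ^ n)
    (hexp : Monoid.exponent G = p ^ m)
    (hcenter : Nat.card (Subgroup.center G) = p ^ k)
    (h : ∀ H₁ H₂ : Subgroup G, H₁ ≠ ⊥ → H₂ ≠ ⊥ → IsCyclic H₁ → IsCyclic H₂ →
      cdMeasure G H₁ = cdMeasure G H₂) :
    (k : ℤ) ≤ (n : ℤ) - 2 * m + 2 := by
  have hp1 := hp.one_lt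
  have : Fact p.Prime := ⟨hp⟩
  have hkn : k ≤ n := by
    have hdvd := Subgroup.card_subgroup_dvd_card (Subgroup.center G)
    rw [hcenter, hcard] at hdvd
    exact (Nat.pow_dvd_pow_iff_le_right hp1).1 hdvd
  rcases Nat.eq_zero_or_pos m with rfl | hm
  · push_cast
    omega
  obtain ⟨x, hx⟩ := hp.exists_orderOf_eq_pow_factorization_exponent G
  rw [hexp, hp.factorization_pow, Finsupp.single_eq_same] at hx
  have hx1 : x ≠ 1 := by
    rintro rfl
    rw [orderOf_one] at hx
    exact (Nat.one_lt_pow hm.ne' hp1).ne hx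
  have : Nontrivial G := ⟨x, 1, hx1⟩
  have : Nontrivial (Subgroup.center G) := (IsPGroup.of_card hcard).center_nontrivial
  have hk : k ≠ 0 := by
    rintro rfl
    have hone := Finite.one_lt_card (α := Subgroup.center G)
    rw [hcenter] at hone
    simp at hone
  obtain ⟨z, hz⟩ := exists_prime_orderOf_dvd_card' (G := Subgroup.center G) p
    (hcenter ▸ dvd_pow_self p hk)
  have hzp : orderOf (z : G) = p := by rw [Subgroup.orderOf_coe, hz]
  have hz1 : (z : G) ≠ 1 := by
    intro h1
    rw [h1, orderOf_one] at hzp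
    exact hp1.ne hzp
  have hcd : ∀ H : Subgroup G, H ≠ ⊥ → IsCyclic H → cdMeasure G H = p * p ^ n := by
    intro H hH hHc
    rw [h H (Subgroup.zpowers (z : G)) hH (by simpa using hz1) hHc inferInstance,
      cdMeasure_of_le_center (by simp), Nat.card_zpowers, hzp, hcard]
  have hinf : Nat.card (Subgroup.zpowers x ⊓ Subgroup.center G : Subgroup G) ≤ p := by
    by_cases hbot : Subgroup.zpowers x ⊓ Subgroup.center G = ⊥
    · rw [hbot, Subgroup.card_bot]
      exact hp1.le
    · have hcyc : IsCyclic (Subgroup.zpowers x ⊓ Subgroup.center G : Subgroup G) :=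
        Subgroup.isCyclic_of_le (inf_le_left (a := Subgroup.zpowers x))
      have hmeas := hcd _ hbot hcyc
      rw [cdMeasure_of_le_center inf_le_right, hcard] at hmeas
      exact (Nat.eq_of_mul_eq_mul_right (pow_pos hp.pos n) hmeas).le
  have hxm := hcd (Subgroup.zpowers x) (by simpa using hx1) inferInstance
  rw [cdMeasure, Nat.card_zpowers, hx] at hxm
  have hmul := Subgroup.card_mul_card_le_card_inf_mul_card
    (Subgroup.le_centralizer (Subgroup.zpowers x))
    (Subgroup.center_le_centralizer (Subgroup.zpowers x : Set G))
  rw [Nat.card_zpowers, hx, hcenter] at hmul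
  have hle : p ^ (k + 2 * m) ≤ p ^ (n + 2) := by
    calc p ^ (k + 2 * m) = p ^ m * (p ^ m * p ^ k) := by ring
      _ ≤ p ^ m * (p * Nat.card (Subgroup.centralizer (Subgroup.zpowers x : Set G))) :=
        Nat.mul_le_mul_left _ (hmul.trans (Nat.mul_le_mul_right _ hinf))
      _ = p * (p ^ m * Nat.card (Subgroup.centralizer (Subgroup.zpowers x : Set G))) := by ring
      _ = p ^ (n + 2) := by rw [hxm]; ring
  have := (Nat.pow_le_pow_iff_right hp1).1 hle
  omega
end

section
/- Let p be a prime and let G be a finite p-group such that every two non-trivial cyclic subgroups of G have the same Chermak–Delgado measure, and suppose the center Z(G) has order exactly p. Then either G is cyclic of order p, or G is isomorphic to the quaternion group Q₈ of order 8. -/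
open Subgroup in
theorem orderOf_mul_card_centralizer {p : ℕ} (hp : p.Prime) {G : Type*} [Group G] [Finite G]
    (h : ∀ H₁ H₂ : Subgroup G, H₁ ≠ ⊥ → H₂ ≠ ⊥ → IsCyclic H₁ → IsCyclic H₂ →
      cdMeasure G H₁ = cdMeasure G H₂)
    (hZ : Nat.card (center G) = p) {x : G} (hx : x ≠ 1) :
    orderOf x * Nat.card (centralizer {x} : Subgroup G) = p * Nat.card G := by
  have := Fact.mk hp
  have hZbot : center G ≠ ⊥ := by
    intro hb
    rw [hb, card_bot] at hZ
    exact hp.one_lt.ne hZ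
  have key := h (zpowers x) (center G) (by simpa using hx) hZbot inferInstance
    (isCyclic_of_prime_card hZ)
  have hc : centralizer (center G : Set G) = ⊤ := centralizer_eq_top_iff_subset.mpr le_rfl
  have hx' : centralizer (zpowers x : Set G) = centralizer {x} := by
    rw [zpowers_eq_closure, centralizer_closure]
  rwa [cdMeasure, cdMeasure, hc, hx', Nat.card_zpowers, hZ, card_top] at key

open Subgroup in
theorem mem_center_of_card_centralizer {G : Type*} [Group G] [Finite G] {x : G}
    (hx : Nat.card (centralizer {x} : Subgroup G) = Nat.card G) : x ∈ center G := by
  have := (card_eq_iff_eq_top _).mp hx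
  rw [centralizer_eq_top_iff_subset] at this
  exact this rfl

open Subgroup in
theorem mem_zpowers_of_commute {p : ℕ} (hp : p.Prime) {G : Type*} [Group G]
    (hZ : Nat.card (center G) = p) (hpow : ∀ w : G, w ^ p = 1 → w ∈ center G) {a b : G}
    (hab : Commute a b) (ha : a ^ p ∈ center G) (hb : b ^ p ∈ center G) (hbZ : b ∉ center G) :
    a ∈ zpowers b := by
  have := Fact.mk hp
  have hb1 : (⟨b ^ p, hb⟩ : center G) ≠ 1 := fun h1 ↦ hbZ (hpow b (congrArg Subtype.val h1))
  have hgen : ∀ c ∈ center G, ∃ i : ℤ, (b ^ p) ^ i = c := fun c hc ↦ by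
    obtain ⟨i, hi⟩ := mem_zpowers_of_prime_card (g' := ⟨c, hc⟩) hZ hb1
    exact ⟨i, congrArg Subtype.val hi⟩
  obtain ⟨i, hi⟩ := hgen _ ha
  have h1 : (a * b ^ (-i)) ^ p = 1 := by
    rw [(hab.zpow_right _).mul_pow, ← hi, ← zpow_natCast, ← zpow_natCast, ← zpow_mul, ← zpow_mul,
      ← zpow_add]
    ring_nf
    simp
  obtain ⟨j, hj⟩ := hgen _ (hpow _ h1)
  have : a = (b ^ p) ^ j * b ^ i := by rw [hj]; simp
  rw [this]
  exact mul_mem (zpow_mem (pow_mem (mem_zpowers b) _) _) (zpow_mem (mem_zpowers b) _)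

open Subgroup in
theorem pow_prime_mem_center_of_not_commute {p : ℕ} (hp : p.Prime) {G : Type*} [Group G]
    (hpG : IsPGroup p G) (hZ : Nat.card (center G) = p)
    (hpow : ∀ w : G, w ^ p = 1 → w ∈ center G) {x y : G} (hx : x ^ p ∈ center G)
    (hxy : ¬ Commute x y) (hcomm : Commute x (y ^ p)) : y ^ p ∈ center G := by
  classical
  have hex : ∃ n, y ^ p ^ n ∈ center G := by
    obtain ⟨k, hk⟩ := hpG y
    exact ⟨k, hk ▸ one_mem _⟩
  obtain ⟨hn, hmin⟩ := Nat.find_spec hex, fun m ↦ Nat.find_min (m := m) hex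
  rcases hfind : Nat.find hex with _ | _ | n
  · rw [hfind] at hn
    exact absurd (by simpa using mem_center_iff.mp hn x : x * y = y * x) hxy
  · simpa [hfind] using hn
  · rw [hfind] at hn hmin
    have hcw : Commute x (y ^ p ^ (n + 1)) := by
      rw [pow_succ', pow_mul]
      exact hcomm.pow_right _
    have hx' := mem_zpowers_of_commute hp hZ hpow hcw hx
      (by rwa [← pow_mul, ← pow_succ]) (hmin (n + 1) (by omega))
    obtain ⟨i, rfl⟩ := hx'
    exact absurd (((Commute.refl y).pow_left _).zpow_left i) hxy

theorem mul_pow_of_commutator_central {G : Type*} [Group G] {a b z : G} (hba : b * a = a * b * z)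
    (hza : Commute z a) (hzb : Commute z b) (n : ℕ) :
    (a * b) ^ n = a ^ n * b ^ n * z ^ n.choose 2 := by
  have hpow : ∀ n : ℕ, b ^ n * a = a * b ^ n * z ^ n := fun n ↦ by
    induction n with
    | zero => simp
    | succ n ih =>
      calc b ^ (n + 1) * a = b ^ n * (b * a) := by rw [pow_succ, mul_assoc]
        _ = (b ^ n * a) * b * z := by rw [hba]; group
        _ = a * b ^ n * (z ^ n * b) * z := by rw [ih]; group
        _ = a * b ^ (n + 1) * z ^ (n + 1) := by rw [(hzb.pow_left n).eq]; group
  induction n with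
  | zero => simp
  | succ n ih =>
    have hch : (n + 1).choose 2 = n + n.choose 2 := by
      rw [Nat.choose_succ_succ' n 1, Nat.choose_one_right]
    calc (a * b) ^ (n + 1) = a ^ n * b ^ n * (z ^ n.choose 2 * (a * b)) := by
          rw [pow_succ, ih]; group
      _ = a ^ n * (b ^ n * a) * b * z ^ n.choose 2 := by
          rw [((hza.mul_right hzb).pow_left _).eq]; group
      _ = a ^ n * a * b ^ n * (z ^ n * b) * z ^ n.choose 2 := by rw [hpow]; group
      _ = a ^ (n + 1) * b ^ (n + 1) * z ^ (n + 1).choose 2 := by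
          rw [(hzb.pow_left n).eq, hch, pow_add z, pow_succ a, pow_succ b]
          simp only [mul_assoc]

open QuaternionGroup in
/-- The homomorphism from `Q₈` sending `a 1` to `x` and `xa 0` to `y`. -/
def quaternionGroupTwoHom {G : Type*} [Group G] (x y : G) (hx : x ^ 4 = 1) (hy : y ^ 2 = x ^ 2)
    (hxy : x * y = y * x⁻¹) : QuaternionGroup 2 →* G :=
  MonoidHom.mk' (fun
    | a i => x ^ i.val
    | xa i => y * x ^ i.val) (by
    have hx3 : x⁻¹ = x ^ 3 := inv_eq_of_mul_eq_one_right (by rw [← pow_succ', hx])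
    have hmod : ∀ m n : ℕ, m % 4 = n % 4 → x ^ m = x ^ n := fun m n hmn ↦ by
      rw [pow_eq_pow_mod m hx, pow_eq_pow_mod n hx, hmn]
    have hmove : ∀ n : ℕ, x ^ n * y = y * x ^ (3 * n) := fun n ↦ by
      rw [pow_mul, ← hx3]
      exact (SemiconjBy.pow_right (show SemiconjBy y x⁻¹ x from hxy.symm) n).symm
    rintro (i | i) (j | j)
    · simp only [a_mul_a]
      rw [← pow_add]
      apply hmod
      revert i j; decide
    · simp only [a_mul_xa]
      rw [← mul_assoc, hmove, mul_assoc, ← pow_add]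
      congr 1
      apply hmod
      revert i j; decide
    · simp only [xa_mul_a]
      rw [mul_assoc, ← pow_add]
      congr 1
      apply hmod
      revert i j; decide
    · simp only [xa_mul_xa]
      rw [mul_assoc, ← mul_assoc _ y, hmove, mul_assoc, ← pow_add, ← mul_assoc, ← pow_two y, hy, ← pow_add]
      apply hmod
      revert i j; decide)

open QuaternionGroup in
theorem quaternionGroupTwoHom_injective {G : Type*} [Group G] {x y : G} (hx : x ^ 4 = 1)
    (hy : y ^ 2 = x ^ 2) (hxy : x * y = y * x⁻¹) (hx2 : x ^ 2 ≠ 1) (hcomm : ¬ Commute x y) :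
    Function.Injective (quaternionGroupTwoHom x y hx hy hxy) := by
  rw [injective_iff_map_eq_one]
  have hord : orderOf x = 2 ^ 2 := orderOf_eq_prime_pow (n := 1) (by simpa using hx2) hx
  rintro (i | i) hi
  · change x ^ i.val = 1 at hi
    have hdvd := orderOf_dvd_of_pow_eq_one hi
    have hlt : i.val < 4 := ZMod.val_lt i
    have : i.val = 0 := Nat.eq_zero_of_dvd_of_lt hdvd (by omega)
    rw [ZMod.val_eq_zero] at this
    rw [this, a_zero]
  · change y * x ^ i.val = 1 at hi
    rw [eq_inv_of_mul_eq_one_left hi] at hcomm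
    exact absurd ((Commute.refl x).pow_right _).inv_right hcomm

/-- If G is a finite p-group whose non-trivial cyclic subgroups all have the same
Chermak–Delgado measure and |Z(G)| = p, then G is cyclic of order p or G ≅ Q₈. -/
theorem stmt_7 (p : ℕ) (hp : p.Prime) (G : Type*) [Group G] [Finite G]
    (hpG : IsPGroup p G)
    (h : ∀ H₁ H₂ : Subgroup G, H₁ ≠ ⊥ → H₂ ≠ ⊥ → IsCyclic H₁ → IsCyclic H₂ →
      cdMeasure G H₁ = cdMeasure G H₂)
    (hZ : Nat.card (Subgroup.center G) = p) :
    (IsCyclic G ∧ Nat.card G = p) ∨ Nonempty (G ≃* QuaternionGroup 2) := by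
  open Subgroup commutatorElement in
  have := Fact.mk hp
  by_cases htop : center G = ⊤
  · left
    rw [htop, card_top] at hZ
    exact ⟨isCyclic_of_prime_card hZ, hZ⟩
  right
  have hcent {x : G} (hx : x ≠ 1) := orderOf_mul_card_centralizer hp h hZ hx
  have hpow : ∀ w : G, w ^ p = 1 → w ∈ center G := by
    intro w hw
    rcases eq_or_ne w 1 with rfl | hw1
    · exact one_mem _
    · have := hcent hw1
      rw [orderOf_eq_prime hw hw1] at this
      exact mem_center_of_card_centralizer (Nat.eq_of_mul_eq_mul_left hp.pos this)
  have hZp : ∀ c ∈ center G, c ^ p = 1 := fun c hc ↦ by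
    have := pow_card_eq_one' (x := (⟨c, hc⟩ : center G))
    rw [hZ] at this
    exact congrArg Subtype.val this
  -- An element `x` of the second center outside the center.
  obtain ⟨x, hxZ, hx⟩ : ∃ x ∉ center G, ∀ g, ⁅g, x⁆ ∈ center G := by
    have : Nontrivial (G ⧸ center G) := QuotientGroup.nontrivial_iff.mpr htop
    have := (hpG.to_quotient (center G)).center_nontrivial
    obtain ⟨⟨q, hq⟩, hq1⟩ := exists_ne (1 : center (G ⧸ center G))
    obtain ⟨x, rfl⟩ := QuotientGroup.mk_surjective q
    refine ⟨x, fun hx ↦ hq1 (Subtype.ext ((QuotientGroup.eq_one_iff x).mpr hx)), fun g ↦ ?_⟩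
    rw [← QuotientGroup.eq_one_iff, commutatorElement_def]
    have := mem_center_iff.mp hq g
    simp only [QuotientGroup.mk_mul, QuotientGroup.mk_inv, this]
    group
  have hcomm : ∀ g, g * x = x * g * ⁅g, x⁆ := fun g ↦ by
    rw [mem_center_iff.mp (hx g)]
    simp [commutatorElement_def, mul_assoc]
  have hcen {z : G} (hz : z ∈ center G) (g : G) : Commute z g := (mem_center_iff.mp hz g).symm
  have hxp : x ^ p ∈ center G := by
    rw [mem_center_iff]
    intro g
    have hs : SemiconjBy g x (x * ⁅g, x⁆) := by
      change g * x = _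
      rw [hcomm, mul_assoc, mul_assoc, (hcen (hx g) g).eq]
    have := hs.pow_right p
    rw [(hcen (hx g) x).symm.mul_pow, hZp _ (hx g), mul_one] at this
    exact this
  obtain ⟨y, hy⟩ : ∃ y, ¬ Commute x y := by
    by_contra! hall
    exact hxZ (mem_center_iff.mpr fun g ↦ (hall g).symm)
  have hyp : ∀ g, ¬ Commute x g → g ^ p ∈ center G := fun g hg ↦ by
    refine pow_prime_mem_center_of_not_commute hp hpG hZ hpow hxp hg ?_
    have hs : SemiconjBy x g (g * ⁅g, x⁆⁻¹) := by
      change x * g = _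
      rw [← (hcen (inv_mem (hx g)) g).eq, (hcen (inv_mem (hx g)) g).eq, mul_assoc,
        (hcen (inv_mem (hx g)) x).eq, ← mul_assoc, hcomm]
      group
    have := hs.pow_right p
    rw [(hcen (inv_mem (hx g)) g).symm.mul_pow, hZp _ (inv_mem (hx g)), mul_one] at this
    exact this
  have hxp1 : x ^ p ≠ 1 := fun h1 ↦ hxZ (hpow x h1)
  rcases hp.eq_two_or_odd' with rfl | hodd
  swap
  · exfalso
    obtain ⟨i, hi⟩ := mem_zpowers_of_prime_card (g := (⟨x ^ p, hxp⟩ : center G))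
      (g' := ⟨y ^ p, hyp y hy⟩) hZ (fun h1 ↦ hxp1 (congrArg Subtype.val h1))
    have hi : (x ^ p) ^ i = y ^ p := congrArg Subtype.val hi
    obtain ⟨z, hz, hyz⟩ : ∃ z ∈ center G, y * x ^ (-i) = x ^ (-i) * y * z := by
      refine ⟨⁅y, x⁆ ^ (-i), zpow_mem (hx y) _, ?_⟩
      have hs : SemiconjBy y x (x * ⁅y, x⁆) := by
        change y * x = _
        rw [hcomm, mul_assoc, mul_assoc, (hcen (hx y) y).eq]
      have := hs.zpow_right (-i)
      rw [(hcen (hx y) x).symm.mul_zpow] at this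
      rw [this.eq, mul_assoc, mul_assoc, (hcen (zpow_mem (hx y) _) y).eq]
    have hz2 : z ^ p.choose 2 = 1 := by
      obtain ⟨k, hk⟩ := hp.dvd_choose_self two_ne_zero
        (lt_of_le_of_ne hp.two_le (fun h2 ↦ by rw [← h2] at hodd; exact absurd hodd (by decide)))
      rw [hk, pow_mul, hZp z hz, one_pow]
    have h1 : (x ^ (-i) * y) ^ p = 1 := by
      rw [mul_pow_of_commutator_central hyz (hcen hz _) (hcen hz _), hz2, mul_one, ← hi,
        ← zpow_natCast, ← zpow_natCast, ← zpow_mul, ← zpow_mul, ← zpow_add]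
      ring_nf
      simp
    have h2 : Commute x (x ^ i * (x ^ (-i) * y)) :=
      ((Commute.refl x).zpow_right i).mul_right (hcen (hpow _ h1) x).symm
    rw [← mul_assoc, ← zpow_add] at h2
    simp at h2
    exact hy h2
  -- From here on `p = 2`.
  have hx4 : x ^ 4 = 1 := by rw [show 4 = 2 * 2 from rfl, pow_mul, hZp _ hxp]
  have huniq : ∀ c ∈ center G, c ≠ 1 → c = x ^ 2 := fun c hc hc1 ↦ by
    obtain ⟨u, v, huv, hall⟩ := Nat.card_eq_two_iff.mp hZ
    have e1 := (hall ▸ Set.mem_univ (1 : center G) : (1 : center G) ∈ ({u, v} : Set _))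
    have e2 := (hall ▸ Set.mem_univ (⟨c, hc⟩ : center G) : (⟨c, hc⟩ : center G) ∈ ({u, v} : Set _))
    have e3 := (hall ▸ Set.mem_univ (⟨_, hxp⟩ : center G) : _ ∈ ({u, v} : Set (center G)))
    have d2 : (⟨c, hc⟩ : center G) ≠ 1 := fun h1 ↦ hc1 (congrArg Subtype.val h1)
    have d3 : (⟨_, hxp⟩ : center G) ≠ 1 := fun h1 ↦ hxp1 (congrArg Subtype.val h1)
    have : (⟨c, hc⟩ : center G) = ⟨_, hxp⟩ := by
      simp only [Set.mem_insert_iff, Set.mem_singleton_iff] at e1 e2 e3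
      grind
    exact congrArg Subtype.val this
  have hsq : ∀ g, ¬ Commute x g → g ^ 2 = x ^ 2 := fun g hg ↦
    huniq _ (hyp g hg) fun h1 ↦ hg (hcen (hpow g h1) x).symm
  have hxy : x * y = y * x⁻¹ := by
    have h1 : ⁅y, x⁆ = x ^ 2 := huniq _ (hx y) fun h1 ↦
      hy (commutatorElement_eq_one_iff_commute.mp h1).symm
    have h2 := hcomm y
    rw [h1, mul_assoc, ← (hcen hxp y).eq, ← mul_assoc, ← pow_succ'] at h2
    have hx3 : x ^ 3 = x⁻¹ := eq_inv_of_mul_eq_one_left (by rw [← pow_succ, hx4])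
    rw [hx3] at h2
    rw [eq_mul_inv_iff_mul_eq, mul_assoc, h2, mul_inv_cancel_left]
  have hindex : ∀ g : G, g ^ 2 = x ^ 2 → (centralizer {g} : Subgroup G).index = 2 := by
    intro g hg
    have hg1 : g ≠ 1 := by
      rintro rfl
      exact hxp1 (by rw [← hg, one_pow])
    have hord : orderOf g = 2 ^ 2 := orderOf_eq_prime_pow (n := 1) (by simpa [hg] using hxp1)
      (by rw [pow_succ, pow_mul, pow_one, hg, hZp _ hxp])
    have h1 := hcent hg1
    rw [hord, ← card_mul_index (centralizer {g} : Subgroup G)] at h1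
    have hpos : 0 < Nat.card (centralizer {g} : Subgroup G) := Nat.card_pos
    nlinarith
  have hinf : (centralizer {x} ⊓ centralizer {y} : Subgroup G) ≤ center G := by
    rintro w ⟨hwx, hwy⟩
    have cwx : Commute x w := mem_centralizer_iff.mp hwx x rfl
    have cwy : Commute y w := mem_centralizer_iff.mp hwy y rfl
    apply hpow
    have h1 : ¬ Commute x (y * w) := fun hc ↦ hy (by simpa using hc.mul_right cwx.inv_right)
    have h2 := hsq _ h1
    rw [cwy.mul_pow, hsq y hy] at h2
    simpa using h2
  have hcard : Nat.card G ≤ 8 := by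
    have h1 := index_inf_le (H := centralizer {x}) (K := (centralizer {y} : Subgroup G))
    rw [hindex x rfl, hindex y (hsq y hy)] at h1
    have h2 := card_le_of_le hinf
    rw [hZ] at h2
    rw [← card_mul_index (centralizer {x} ⊓ centralizer {y} : Subgroup G)]
    exact Nat.mul_le_mul h2 h1
  have hinj := quaternionGroupTwoHom_injective hx4 (hsq y hy) hxy hxp1 hy
  exact ⟨(MulEquiv.ofBijective _ ((Nat.bijective_iff_injective_and_card _).mpr ⟨hinj,
    le_antisymm (Nat.card_le_card_of_injective _ hinj)
      (by rwa [Nat.card_eq_fintype_card (α := QuaternionGroup 2), QuaternionGroup.card])⟩)).symm⟩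
end

section
/- For every natural number n, the group G = Q₈ × C₂ⁿ (the direct product of the quaternion group of order 8 with n copies of the cyclic group of order 2) has the property that every two non-trivial cyclic subgroups of G have the same Chermak–Delgado measure. -/
theorem QuaternionGroup.two_sq_eq_one_or_sq_ne_one (q : QuaternionGroup 2) :
    (q ^ 2 = 1 ∧ Fintype.card {x : QuaternionGroup 2 // x * q = q * x} = 8) ∨
      (q ^ 2 ≠ 1 ∧ q ^ 4 = 1 ∧ Fintype.card {x : QuaternionGroup 2 // x * q = q * x} = 4) := by
  revert q
  decide

theorem Subgroup.card_centralizer_singleton_prod {G A : Type*} [Group G] [CommGroup A]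
    (g : G) (a : A) :
    Nat.card (centralizer {(g, a)}) = Nat.card {x : G // x * g = g * x} * Nat.card A := by
  rw [← Nat.card_prod]
  refine Nat.card_congr
    { toFun := fun z => (⟨z.1.1, ?_⟩, z.1.2)
      invFun := fun z => ⟨(z.1.1, z.2), ?_⟩
      left_inv := fun _ => rfl
      right_inv := fun _ => rfl }
  · exact congrArg Prod.fst (mem_centralizer_singleton_iff.1 z.2)
  · exact mem_centralizer_singleton_iff.2 (Prod.ext z.1.2 (mul_comm _ _))

theorem cdMeasure_zpowers {G : Type*} [Group G] (g : G) :
    cdMeasure G (Subgroup.zpowers g) = orderOf g * Nat.card (Subgroup.centralizer {g}) := by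
  rw [cdMeasure, Nat.card_zpowers, Subgroup.zpowers_eq_closure, Subgroup.centralizer_closure]

theorem cdMeasure_zpowers_quaternionGroup_prod {A : Type*} [CommGroup A]
    (hA : ∀ a : A, a ^ 2 = 1) (g : QuaternionGroup 2 × A) (hg : g ≠ 1) :
    cdMeasure (QuaternionGroup 2 × A) (Subgroup.zpowers g) = 16 * Nat.card A := by
  obtain ⟨q, a⟩ := g
  rw [cdMeasure_zpowers, Subgroup.card_centralizer_singleton_prod,
    Nat.card_eq_fintype_card (α := {x : QuaternionGroup 2 // x * q = q * x})]
  rcases QuaternionGroup.two_sq_eq_one_or_sq_ne_one q with ⟨hq, hc⟩ | ⟨hq, hq', hc⟩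
  · have ho : orderOf (q, a) = 2 := orderOf_eq_prime (Prod.ext hq (hA a)) hg
    rw [hc, ho]
    ring
  · have ho : orderOf (q, a) = 2 ^ (1 + 1) :=
      orderOf_eq_prime_pow (fun h => hq (congrArg Prod.fst h))
        (Prod.ext hq' ((pow_mul a 2 2).trans (by simp [hA])))
    rw [hc, ho]
    ring

theorem cdMeasure_quaternionGroup_prod_of_isCyclic {A : Type*} [CommGroup A]
    (hA : ∀ a : A, a ^ 2 = 1) (H : Subgroup (QuaternionGroup 2 × A)) (hH : H ≠ ⊥)
    (hc : IsCyclic H) :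
    cdMeasure (QuaternionGroup 2 × A) H = 16 * Nat.card A := by
  obtain ⟨g, rfl⟩ := (Subgroup.isCyclic_iff_exists_zpowers_eq_top H).1 hc
  exact cdMeasure_zpowers_quaternionGroup_prod hA g (Subgroup.zpowers_ne_bot.1 hH)

/-- For every n, in G = Q₈ × C₂ⁿ every two non-trivial cyclic subgroups have
the same Chermak–Delgado measure. -/
theorem stmt_10 (n : ℕ) :
    ∀ H₁ H₂ : Subgroup (QuaternionGroup 2 × (Fin n → Multiplicative (ZMod 2))),
      H₁ ≠ ⊥ → H₂ ≠ ⊥ → IsCyclic H₁ → IsCyclic H₂ →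
      cdMeasure (QuaternionGroup 2 × (Fin n → Multiplicative (ZMod 2))) H₁ =
        cdMeasure (QuaternionGroup 2 × (Fin n → Multiplicative (ZMod 2))) H₂ := by
  intro H₁ H₂ h₁ h₂ hc₁ hc₂
  have hA (a : Fin n → Multiplicative (ZMod 2)) : a ^ 2 = 1 :=
    funext fun i => (by decide : ∀ x : Multiplicative (ZMod 2), x ^ 2 = 1) (a i)
  rw [cdMeasure_quaternionGroup_prod_of_isCyclic hA H₁ h₁ hc₁,
    cdMeasure_quaternionGroup_prod_of_isCyclic hA H₂ h₂ hc₂]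
end

section
/- Let G be a finite group such that every two non-trivial cyclic subgroups of G have the same Chermak–Delgado measure, and suppose G is isomorphic to a generalized quaternion group Q_{2^n} of order 2^n with n ≥ 3. Then n = 3, i.e., G is isomorphic to Q₈. -/
theorem cdMeasure_map_mulEquiv {G G' : Type*} [Group G] [Group G'] (e : G ≃* G')
    (H : Subgroup G) : cdMeasure G' (H.map (e : G →* G')) = cdMeasure G H := by
  have hc : Subgroup.centralizer (H.map (e : G →* G') : Set G') =
      (Subgroup.centralizer (H : Set G)).map (e : G →* G') := by
    ext y
    obtain ⟨x, rfl⟩ := e.surjective y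
    simp [Subgroup.mem_centralizer_iff, ← map_mul]
  unfold cdMeasure
  rw [hc, Subgroup.card_map_of_injective e.injective, Subgroup.card_map_of_injective e.injective]

namespace QuaternionGroup

variable {N : ℕ}

theorem a_mem_zpowers_a_one [NeZero N] (i : ZMod (2 * N)) :
    a i ∈ Subgroup.zpowers (a 1 : QuaternionGroup N) :=
  Subgroup.mem_zpowers_iff.2 ⟨i.val, by rw [zpow_natCast, a_one_pow, ZMod.natCast_zmod_val]⟩

theorem centralizer_zpowers_a_one (hN : 2 ≤ N) :
    Subgroup.centralizer (Subgroup.zpowers (a 1 : QuaternionGroup N) : Set (QuaternionGroup N)) =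
      Subgroup.zpowers (a 1) := by
  have : NeZero N := ⟨by omega⟩
  refine le_antisymm ?_ (Subgroup.le_centralizer _)
  rintro (i | i) hx
  · exact a_mem_zpowers_a_one i
  · have hcomm := Subgroup.mem_centralizer_iff.1 hx (a 1) (Subgroup.mem_zpowers _)
    rw [a_mul_xa, xa_mul_a, xa.injEq] at hcomm
    have h2 : ((2 : ℕ) : ZMod (2 * N)) = 0 := by
      push_cast
      linear_combination -hcomm
    have := Nat.le_of_dvd two_pos ((ZMod.natCast_eq_zero_iff _ _).1 h2)
    omega

theorem cdMeasure_zpowers_a_one (hN : 2 ≤ N) :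
    cdMeasure (QuaternionGroup N) (Subgroup.zpowers (a 1)) = 2 * N * (2 * N) := by
  rw [cdMeasure, centralizer_zpowers_a_one hN, Nat.card_zpowers, orderOf_a_one]

theorem a_natCast_self_ne_one [NeZero N] : (a N : QuaternionGroup N) ≠ 1 := by
  rw [one_def, Ne, a.injEq, ZMod.natCast_eq_zero_iff]
  intro hdvd
  have := Nat.le_of_dvd (Nat.pos_of_neZero N) hdvd
  have := Nat.pos_of_neZero N
  omega

theorem natCast_add_self : (N : ZMod (2 * N)) + N = 0 := by
  rw [← two_mul]
  exact_mod_cast ZMod.natCast_self (2 * N)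

theorem orderOf_a_natCast_self [NeZero N] : orderOf (a N : QuaternionGroup N) = 2 :=
  orderOf_eq_prime (by rw [sq, a_mul_a, natCast_add_self, a_zero]) a_natCast_self_ne_one

theorem a_natCast_self_mem_center : (a N : QuaternionGroup N) ∈ Subgroup.center _ := by
  rw [Subgroup.mem_center_iff]
  rintro (i | i)
  · rw [a_mul_a, a_mul_a, add_comm]
  · rw [a_mul_xa, xa_mul_a, xa.injEq]
    linear_combination natCast_add_self (N := N)

theorem cdMeasure_zpowers_a_natCast_self [NeZero N] :
    cdMeasure (QuaternionGroup N) (Subgroup.zpowers (a N)) = 2 * (4 * N) := by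
  have hc : Subgroup.centralizer
      (Subgroup.zpowers (a N : QuaternionGroup N) : Set (QuaternionGroup N)) = ⊤ := by
    rw [Subgroup.centralizer_eq_top_iff_subset, SetLike.coe_subset_coe, Subgroup.zpowers_le]
    exact a_natCast_self_mem_center
  rw [cdMeasure, hc, Nat.card_zpowers, orderOf_a_natCast_self, Subgroup.card_top,
    Nat.card_eq_fintype_card, card]

end QuaternionGroup

/-- If a finite group G, all of whose non-trivial cyclic subgroups have the same
Chermak–Delgado measure, is a generalized quaternion group of order 2^n (n ≥ 3),
then n = 3, i.e. G ≅ Q₈.  (Q_{2^n} = QuaternionGroup (2^(n-2)), of order 4·2^(n-2).) -/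
theorem stmt_11 (G : Type*) [Group G] [Finite G] (n : ℕ) (hn : 3 ≤ n)
    (h : ∀ H₁ H₂ : Subgroup G, H₁ ≠ ⊥ → H₂ ≠ ⊥ → IsCyclic H₁ → IsCyclic H₂ →
      cdMeasure G H₁ = cdMeasure G H₂)
    (hQ : Nonempty (G ≃* QuaternionGroup (2 ^ (n - 2)))) :
    n = 3 := by
  obtain ⟨e⟩ := hQ
  have hpow : 2 ≤ 2 ^ (n - 2) := Nat.le_self_pow (by omega) 2
  have hzpowers (x : QuaternionGroup (2 ^ (n - 2))) :
      cdMeasure G (Subgroup.zpowers (e.symm x)) = cdMeasure _ (Subgroup.zpowers x) := by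
    rw [← cdMeasure_map_mulEquiv e.symm, MonoidHom.map_zpowers]
    rfl
  have hne {x : QuaternionGroup (2 ^ (n - 2))} (hx : x ≠ 1) :
      Subgroup.zpowers (e.symm x) ≠ ⊥ := by
    simpa using hx
  have ha : (QuaternionGroup.a 1 : QuaternionGroup (2 ^ (n - 2))) ≠ 1 := by
    rw [Ne, ← orderOf_eq_one_iff, QuaternionGroup.orderOf_a_one]
    omega
  have hcd := h _ _ (hne ha) (hne QuaternionGroup.a_natCast_self_ne_one) inferInstance inferInstance
  rw [hzpowers, hzpowers, QuaternionGroup.cdMeasure_zpowers_a_one hpow,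
    QuaternionGroup.cdMeasure_zpowers_a_natCast_self] at hcd
  have hexp : 2 ^ (n - 2) = 2 ^ 1 := by nlinarith
  have := Nat.pow_right_injective le_rfl hexp
  omega
end

section
/- Let G be a finite group in which some Sylow p-subgroup is non-trivial for two distinct primes p and q dividing |G| (i.e., |G| is divisible by at least two distinct primes). Then there exist non-trivial cyclic subgroups H₁ and H₂ of G with m_G(H₁) ≠ m_G(H₂): namely, if P is a subgroup of order p contained in the center of a Sylow p-subgroup and Q is a subgroup of order q contained in the center of a Sylow q-subgroup, then m_G(P) ≠ m_G(Q). -/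
/-- The measure of a central subgroup of order `p` of a Sylow `p`-subgroup is divisible by
`p` times the `p`-part of `|G|`. -/
theorem mul_card_sylow_dvd_cdMeasure {G : Type*} [Group G] {p : ℕ} (S : Sylow p G)
    {P : Subgroup G} (hcard : Nat.card P = p)
    (hP : P ≤ (Subgroup.center (S : Subgroup G)).map (S : Subgroup G).subtype) :
    p * Nat.card S ∣ cdMeasure G P := by
  have hle : (S : Subgroup G) ≤ Subgroup.centralizer (P : Set G) := by
    intro x hx
    rw [Subgroup.mem_centralizer_iff]
    intro y hy
    obtain ⟨z, hz, rfl⟩ := hP hy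
    exact congrArg Subtype.val (Subgroup.mem_center_iff.mp hz ⟨x, hx⟩).symm
  rw [cdMeasure, hcard]
  exact mul_dvd_mul_left p (Subgroup.card_dvd_of_le hle)

/-- The measure of a subgroup of order prime to `p` is not divisible by `p` times the
`p`-part of `|G|`. -/
theorem not_mul_card_sylow_dvd_cdMeasure {G : Type*} [Group G] [Finite G] {p : ℕ}
    (hp : p.Prime) (S : Sylow p G) {Q : Subgroup G} (hQ : p.Coprime (Nat.card Q)) :
    ¬ p * Nat.card S ∣ cdMeasure G Q := by
  have : Fact p.Prime := ⟨hp⟩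
  rw [cdMeasure, S.card_eq_multiplicity, ← pow_succ']
  intro h
  exact Nat.pow_succ_factorization_not_dvd Nat.card_pos.ne' hp
    (((hQ.pow_left _).dvd_of_dvd_mul_left h).trans (Subgroup.card_subgroup_dvd_card _))

/-- If |G| is divisible by two distinct primes p and q, and P (resp. Q) is a
subgroup of order p (resp. q) contained in the center of a Sylow p-subgroup
(resp. Sylow q-subgroup), then P and Q are non-trivial cyclic subgroups with
different Chermak–Delgado measures. -/
theorem stmt_12 (G : Type*) [Group G] [Finite G] (p q : ℕ)
    (hp : p.Prime) (hq : q.Prime) (hpq : p ≠ q)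
    (hpd : p ∣ Nat.card G) (hqd : q ∣ Nat.card G)
    (Sp : Sylow p G) (Sq : Sylow q G) (P Q : Subgroup G)
    (hPcard : Nat.card P = p) (hQcard : Nat.card Q = q)
    (hPZ : P ≤ (Subgroup.center (Sp : Subgroup G)).map (Sp : Subgroup G).subtype)
    (hQZ : Q ≤ (Subgroup.center (Sq : Subgroup G)).map (Sq : Subgroup G).subtype) :
    P ≠ ⊥ ∧ Q ≠ ⊥ ∧ IsCyclic P ∧ IsCyclic Q ∧ cdMeasure G P ≠ cdMeasure G Q := by
  have : Fact p.Prime := ⟨hp⟩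
  have : Fact q.Prime := ⟨hq⟩
  refine ⟨?_, ?_, isCyclic_of_prime_card hPcard, isCyclic_of_prime_card hQcard, ?_⟩
  · rintro rfl
    exact hp.ne_one (hPcard.symm.trans Subgroup.card_bot)
  · rintro rfl
    exact hq.ne_one (hQcard.symm.trans Subgroup.card_bot)
  · intro h
    have hcop : p.Coprime (Nat.card Q) := hQcard ▸ (Nat.coprime_primes hp hq).mpr hpq
    exact not_mul_card_sylow_dvd_cdMeasure hp Sp hcop
      (h ▸ mul_card_sylow_dvd_cdMeasure Sp hPcard hPZ)
end
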